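/- Convexity of the expected post-channel value: for any channel j, the function g(b) = ∑_{o : P(o|b,j)>0} P(o|b,j) · V(b̂(j,o)) is convex on the probability simplex: for beliefs p, q and t ∈ [0,1], g(t·p + (1−t)·q) ≤ t·g(p) + (1−t)·g(q). -/

import Mathlib

open Finset

/-- `b` is a probability distribution (belief) on the finite state set `S`. -/
def IsBelief {S : Type*} [Fintype S] (b : S → ℝ) : Prop :=
  (∀ s, 0 ≤ b s) ∧ ∑ s, b s = 1

/-- `P` is a likelihood kernel: for each state `s`, `P · s` is a probability
distribution on the finite outcome set `O`. -/
def IsKernel {S O : Type*} [Fintype S] [Fintype O] (P : O → S → ℝ) : Prop :=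
  (∀ o s, 0 ≤ P o s) ∧ ∀ s, ∑ o, P o s = 1

/-- Marginal outcome probability `P(o | b, k) = ∑ s, P(o | s, k) b(s)`. -/
noncomputable def marginal {S O : Type*} [Fintype S] [Fintype O] (b : S → ℝ) (P : O → S → ℝ) (o : O) : ℝ :=
  ∑ s, P o s * b s

/-- Posterior belief `b̂(k, o)(s) = P(o | s, k) b(s) / P(o | b, k)`. -/
noncomputable def posterior {S O : Type*} [Fintype S] [Fintype O] (b : S → ℝ) (P : O → S → ℝ) (o : O)
    (s : S) : ℝ :=
  P o s * b s / marginal b P o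

/-- Jensen gap of `f` at belief `b` under the channel with kernel `P`:
`∑_{o : P(o|b) > 0} P(o|b) f(b̂(o)) − f(b)`. -/
noncomputable def jensenGap {S O : Type*} [Fintype S] [Fintype O] (f : (S → ℝ) → ℝ) (b : S → ℝ)
    (P : O → S → ℝ) : ℝ :=
  (∑ o ∈ Finset.univ.filter (fun o => 0 < marginal b P o),
      marginal b P o * f (posterior b P o)) - f b

/-- Value function `V(b) = max_{a ∈ A} ∑ s, R(a,s) b(s)`. -/
noncomputable def Val {S A : Type*} [Fintype S] [Fintype A] [Nonempty A] (R : A → S → ℝ) (b : S → ℝ) : ℝ :=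
  Finset.univ.sup' Finset.univ_nonempty (fun a => ∑ s, R a s * b s)

/-- `p` lies in the decision region `ℛ_a`. -/
def InRegion {S A : Type*} [Fintype S] (R : A → S → ℝ) (a : A) (p : S → ℝ) : Prop :=
  ∀ a', ∑ s, R a' s * p s ≤ ∑ s, R a s * p s

/-- Value of information of the channel with kernel `P` at belief `b`. -/
noncomputable def VoI {S A O : Type*} [Fintype S] [Fintype A] [Nonempty A] [Fintype O]
    (R : A → S → ℝ) (P : O → S → ℝ) (b : S → ℝ) : ℝ :=
  jensenGap (Val R) b P

/-- Second-order interaction `ΔVoI(j | i, b)`. -/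
noncomputable def deltaVoI {S A Oi Oj : Type*} [Fintype S] [Fintype A] [Nonempty A] [Fintype Oi] [Fintype Oj]
    (R : A → S → ℝ) (Pi : Oi → S → ℝ) (Pj : Oj → S → ℝ) (b : S → ℝ) : ℝ :=
  (∑ oi ∈ Finset.univ.filter (fun oi => 0 < marginal b Pi oi),
      marginal b Pi oi * VoI R Pj (posterior b Pi oi)) - VoI R Pj b

/-- Expected post-channel-`j` value `g(b) = ∑_{o_j : P(o_j|b,j)>0} P(o_j|b,j) V(b̂(j,o_j))`. -/
noncomputable def expectedPostValue {S A Oj : Type*} [Fintype S] [Fintype A] [Nonempty A]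
    [Fintype Oj] (R : A → S → ℝ) (Pj : Oj → S → ℝ) (b : S → ℝ) : ℝ :=
  ∑ oj ∈ Finset.univ.filter (fun oj => 0 < marginal b Pj oj),
    marginal b Pj oj * Val R (posterior b Pj oj)

theorem Val_smul {S A : Type*} [Fintype S] [Fintype A] [Nonempty A] (R : A → S → ℝ)
    {c : ℝ} (hc : 0 ≤ c) (b : S → ℝ) : Val R (c • b) = c * Val R b := by
  unfold Val
  rw [Finset.mul₀_sup' hc]
  simp only [Pi.smul_apply, smul_eq_mul, Finset.mul_sum, mul_left_comm]

theorem Val_add_le {S A : Type*} [Fintype S] [Fintype A] [Nonempty A] (R : A → S → ℝ)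
    (b c : S → ℝ) : Val R (b + c) ≤ Val R b + Val R c := by
  unfold Val
  refine Finset.sup'_le _ _ fun a ha => ?_
  simp only [Pi.add_apply, mul_add, Finset.sum_add_distrib]
  exact add_le_add (Finset.le_sup' (fun a => ∑ s, R a s * b s) ha)
    (Finset.le_sup' (fun a => ∑ s, R a s * c s) ha)

/-- By homogeneity of `Val`, the expected post-channel value is a sum of values at the
unnormalised posteriors. -/
theorem expectedPostValue_eq_sum {S A O : Type*} [Fintype S] [Fintype A] [Nonempty A]
    [Fintype O] (R : A → S → ℝ) (P : O → S → ℝ) (hP : ∀ o s, 0 ≤ P o s)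
    (b : S → ℝ) (hb : ∀ s, 0 ≤ b s) :
    expectedPostValue R P b = ∑ o, Val R (P o * b) := by
  unfold expectedPostValue
  rw [Finset.sum_filter]
  refine Finset.sum_congr rfl fun o _ => ?_
  have hnonneg : ∀ s ∈ Finset.univ, 0 ≤ P o s * b s := fun s _ => mul_nonneg (hP o s) (hb s)
  split_ifs with h
  · rw [← Val_smul R h.le]
    congr 1
    ext s
    simp only [Pi.smul_apply, smul_eq_mul, Pi.mul_apply, posterior]
    exact mul_div_cancel₀ _ h.ne'
  · have hzero : marginal b P o = 0 := le_antisymm (not_lt.mp h) (Finset.sum_nonneg hnonneg)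
    have hPb : P o * b = 0 := by
      ext s
      exact (Finset.sum_eq_zero_iff_of_nonneg hnonneg).mp hzero s (Finset.mem_univ s)
    rw [hPb]
    simp [Val]

/-- **Convexity of the expected post-channel value** `g` on the probability simplex. -/
theorem expectedPostValue_convexOn {S A Oj : Type*} [Fintype S] [Nonempty S]
    [Fintype A] [Nonempty A] [Fintype Oj]
    (R : A → S → ℝ) (Pj : Oj → S → ℝ) (hPj : IsKernel Pj)
    (p q : S → ℝ) (hp : IsBelief p) (hq : IsBelief q)
    (t : ℝ) (ht0 : 0 ≤ t) (ht1 : t ≤ 1) :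
    expectedPostValue R Pj (fun s => t * p s + (1 - t) * q s) ≤
      t * expectedPostValue R Pj p + (1 - t) * expectedPostValue R Pj q := by
  have hs : 0 ≤ 1 - t := sub_nonneg.mpr ht1
  rw [expectedPostValue_eq_sum R Pj hPj.1 _ fun s =>
      add_nonneg (mul_nonneg ht0 (hp.1 s)) (mul_nonneg hs (hq.1 s)),
    expectedPostValue_eq_sum R Pj hPj.1 p hp.1, expectedPostValue_eq_sum R Pj hPj.1 q hq.1,
    Finset.mul_sum, Finset.mul_sum, ← Finset.sum_add_distrib]
  refine Finset.sum_le_sum fun o _ => ?_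
  rw [← Val_smul R ht0, ← Val_smul R hs]
  have hmix : Pj o * (fun s => t * p s + (1 - t) * q s) =
      t • (Pj o * p) + (1 - t) • (Pj o * q) := by
    ext s
    simp only [Pi.mul_apply, Pi.add_apply, Pi.smul_apply, smul_eq_mul]
    ring
  rw [hmix]
  exact Val_add_le R _ _
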